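/- Suppose for each n the vector ℚ_n consists of an orthonormal basis of 𝒱_n²(w,ℂ) satisfying ℚ_n = J_{n+1} conj(ℚ_n) and the three-term relation z ℚ_n = α_n ℚ_{n+1} + β_n ℚ_n + (α_{n−1}*)^∨ ℚ_{n−1}. Then the coefficient matrices satisfy the commuting conditions: α_n α_{n+1}^∨ = α_n^∨ α_{n+1}; α_n β_{n+1}^∨ + β_n α_n^∨ = β_n^∨ α_n + α_n^∨ β_{n+1}; and α_n α_n* + β_n β_n* + (α_{n−1}*)^∨ α_{n−1}^∨ = α_{n−1}^∨ (α_{n−1}^∨)* + β_n* β_n + α_n* α_n. -/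

import Mathlib

open MeasureTheory MvPolynomial Matrix Complex
open scoped ComplexOrder

noncomputable section

/-- Evaluation of a polynomial in the two commuting variables `(z, z̄)` at a point `z ∈ ℂ`. -/
def evalz (p : MvPolynomial (Fin 2) ℂ) (z : ℂ) : ℂ :=
  MvPolynomial.eval (fun i : Fin 2 => if i = 0 then z else (starRingEnd ℂ) z) p

/-- The complex inner product `⟨f,g⟩ = ∫_Ω f conj(g) w`. -/
def cip (Ω : Set ℂ) (w : ℂ → ℝ) (p q : MvPolynomial (Fin 2) ℂ) : ℂ :=
  ∫ z in Ω, evalz p z * (starRingEnd ℂ) (evalz q z) * (w z : ℂ)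
/-- Conjugation of a polynomial in `(z, z̄)`: conjugate the coefficients and swap `z` and `z̄`. -/
def pconj (p : MvPolynomial (Fin 2) ℂ) : MvPolynomial (Fin 2) ℂ :=
  MvPolynomial.rename (Equiv.swap (0 : Fin 2) 1) (MvPolynomial.map (starRingEnd ℂ) p)
/-- Membership in `𝒱_n²(w,ℂ)`: total degree at most `n` and orthogonality to all
polynomials of total degree at most `n-1`. -/
def memV (Ω : Set ℂ) (w : ℂ → ℝ) (n : ℕ) (p : MvPolynomial (Fin 2) ℂ) : Prop :=
  p.totalDegree ≤ n ∧ ∀ q : MvPolynomial (Fin 2) ℂ, q.totalDegree < n → cip Ω w p q = 0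

/-- The `m × m` backward identity matrix. -/
def Jmat (m : ℕ) : Matrix (Fin m) (Fin m) ℂ :=
  fun r s => if r.1 + s.1 = m - 1 then 1 else 0

/-- `M^∨ = J_a conj(M) J_b` for an `a × b` complex matrix `M`. -/
def vee {a b : ℕ} (M : Matrix (Fin a) (Fin b) ℂ) : Matrix (Fin a) (Fin b) ℂ :=
  Jmat a * M.map (starRingEnd ℂ) * Jmat b

lemma evalz_add (p q : MvPolynomial (Fin 2) ℂ) (z : ℂ) :
    evalz (p + q) z = evalz p z + evalz q z := by
  simp [evalz]

lemma evalz_smul (c : ℂ) (p : MvPolynomial (Fin 2) ℂ) (z : ℂ) :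
    evalz (c • p) z = c * evalz p z := by
  simp [evalz]

lemma cip_conj_symm (Ω : Set ℂ) (w : ℂ → ℝ) (p q : MvPolynomial (Fin 2) ℂ) :
    (starRingEnd ℂ) (cip Ω w p q) = cip Ω w q p := by
  unfold cip
  rw [← integral_conj]
  congr 1
  ext z
  simp only [map_mul, Complex.conj_conj, Complex.conj_ofReal]
  ring

lemma cip_smul_left (Ω : Set ℂ) (w : ℂ → ℝ) (c : ℂ) (p q : MvPolynomial (Fin 2) ℂ) :
    cip Ω w (c • p) q = c * cip Ω w p q := by
  unfold cip
  rw [← integral_const_mul]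
  congr 1
  ext z
  rw [evalz_smul]
  ring

/-- All products of two polynomials in `(z, z̄)` are integrable against the weight. -/
def HasMoments (Ω : Set ℂ) (w : ℂ → ℝ) : Prop :=
  ∀ p q : MvPolynomial (Fin 2) ℂ,
    IntegrableOn (fun z => evalz p z * (starRingEnd ℂ) (evalz q z) * (w z : ℂ)) Ω

lemma cip_add_left {Ω : Set ℂ} {w : ℂ → ℝ} (h : HasMoments Ω w)
    (p p' q : MvPolynomial (Fin 2) ℂ) :
    cip Ω w (p + p') q = cip Ω w p q + cip Ω w p' q := by
  unfold cip
  rw [← integral_add (h p q) (h p' q)]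
  congr 1
  ext z
  rw [evalz_add]
  ring

lemma cip_sum_left {Ω : Set ℂ} {w : ℂ → ℝ} (h : HasMoments Ω w) {ι : Type*} (s : Finset ι)
    (f : ι → MvPolynomial (Fin 2) ℂ) (q : MvPolynomial (Fin 2) ℂ) :
    cip Ω w (∑ i ∈ s, f i) q = ∑ i ∈ s, cip Ω w (f i) q :=
  map_sum (AddMonoidHom.mk' (fun p => cip Ω w p q) fun p p' => cip_add_left h p p' q) f s

lemma cip_X_one_mul_left (Ω : Set ℂ) (w : ℂ → ℝ) (p q : MvPolynomial (Fin 2) ℂ) :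
    cip Ω w (X 1 * p) q = cip Ω w p (X 0 * q) := by
  unfold cip
  congr 1
  ext z
  simp only [evalz, map_mul, eval_X, if_true, one_ne_zero, if_false]
  ring

lemma cip_X_one_mul_X_one_mul (Ω : Set ℂ) (w : ℂ → ℝ) (p q : MvPolynomial (Fin 2) ℂ) :
    cip Ω w (X 1 * p) (X 1 * q) = cip Ω w (X 0 * p) (X 0 * q) := by
  unfold cip
  congr 1
  ext z
  simp only [evalz, map_mul, eval_X, if_true, one_ne_zero, if_false, Complex.conj_conj]
  ring

lemma pconj_X_zero_mul (p : MvPolynomial (Fin 2) ℂ) : pconj (X 0 * p) = X 1 * pconj p := by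
  simp [pconj]

lemma pconj_add (p q : MvPolynomial (Fin 2) ℂ) : pconj (p + q) = pconj p + pconj q := by
  simp [pconj]

lemma pconj_sum_smul {ι : Type*} (s : Finset ι) (c : ι → ℂ)
    (f : ι → MvPolynomial (Fin 2) ℂ) :
    pconj (∑ i ∈ s, c i • f i) = ∑ i ∈ s, (starRingEnd ℂ) (c i) • pconj (f i) := by
  simp [pconj, MvPolynomial.smul_eq_C_mul]

lemma Jmat_apply (m : ℕ) (r s : Fin m) : Jmat m r s = if s = r.rev then 1 else 0 := by
  unfold Jmat
  congr 1
  rw [Fin.ext_iff, Fin.val_rev]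
  apply propext
  omega

lemma vee_apply {a b : ℕ} (M : Matrix (Fin a) (Fin b) ℂ) (k : Fin a) (j : Fin b) :
    vee M k j = (starRingEnd ℂ) (M k.rev j.rev) := by
  have h : ∀ x : Fin b, j = x.rev ↔ x = j.rev := fun x => by
    rw [eq_comm, Fin.rev_eq_iff]
  simp [vee, Matrix.mul_apply, Jmat_apply, h]

lemma vee_vee {a b : ℕ} (M : Matrix (Fin a) (Fin b) ℂ) : vee (vee M) = M := by
  ext k j
  simp [vee_apply]

lemma vee_conjTranspose {a b : ℕ} (M : Matrix (Fin a) (Fin b) ℂ) : vee Mᴴ = (vee M)ᴴ := by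
  ext k j
  simp [vee_apply]

/-- The action of a matrix on a vector of polynomials. -/
def matAct {a b : ℕ} (A : Matrix (Fin a) (Fin b) ℂ) (u : Fin b → MvPolynomial (Fin 2) ℂ) :
    Fin a → MvPolynomial (Fin 2) ℂ :=
  fun k => ∑ j, A k j • u j

/-- Multiplication of a vector of polynomials by the variable `z` (`i = 0`) or `z̄` (`i = 1`). -/
def mulVar {a : ℕ} (i : Fin 2) (u : Fin a → MvPolynomial (Fin 2) ℂ) :
    Fin a → MvPolynomial (Fin 2) ℂ :=
  fun k => X i * u k

/-- The matrix `∫_Ω u v* w` of inner products of two vectors of polynomials. -/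
def gramMat (Ω : Set ℂ) (w : ℂ → ℝ) {a b : ℕ} (u : Fin a → MvPolynomial (Fin 2) ℂ)
    (v : Fin b → MvPolynomial (Fin 2) ℂ) : Matrix (Fin a) (Fin b) ℂ :=
  Matrix.of fun k j => cip Ω w (u k) (v j)

lemma gramMat_conjTranspose (Ω : Set ℂ) (w : ℂ → ℝ) {a b : ℕ}
    (u : Fin a → MvPolynomial (Fin 2) ℂ) (v : Fin b → MvPolynomial (Fin 2) ℂ) :
    (gramMat Ω w u v)ᴴ = gramMat Ω w v u := by
  ext k j
  simpa [gramMat] using cip_conj_symm Ω w (u j) (v k)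

section gramMat

variable {Ω : Set ℂ} {w : ℂ → ℝ} {a b c : ℕ}

lemma gramMat_add_left (h : HasMoments Ω w) (u u' : Fin a → MvPolynomial (Fin 2) ℂ)
    (v : Fin b → MvPolynomial (Fin 2) ℂ) :
    gramMat Ω w (u + u') v = gramMat Ω w u v + gramMat Ω w u' v := by
  ext k j
  simp [gramMat, cip_add_left h]

lemma gramMat_add_right (h : HasMoments Ω w) (u : Fin a → MvPolynomial (Fin 2) ℂ)
    (v v' : Fin b → MvPolynomial (Fin 2) ℂ) :
    gramMat Ω w u (v + v') = gramMat Ω w u v + gramMat Ω w u v' := by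
  rw [← gramMat_conjTranspose, gramMat_add_left h, conjTranspose_add, gramMat_conjTranspose,
    gramMat_conjTranspose]

lemma gramMat_matAct_left (h : HasMoments Ω w) (A : Matrix (Fin a) (Fin b) ℂ)
    (u : Fin b → MvPolynomial (Fin 2) ℂ) (v : Fin c → MvPolynomial (Fin 2) ℂ) :
    gramMat Ω w (matAct A u) v = A * gramMat Ω w u v := by
  ext k j
  simp [gramMat, matAct, cip_sum_left h, cip_smul_left, Matrix.mul_apply]

lemma gramMat_matAct_right (h : HasMoments Ω w) (A : Matrix (Fin a) (Fin b) ℂ)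
    (u : Fin c → MvPolynomial (Fin 2) ℂ) (v : Fin b → MvPolynomial (Fin 2) ℂ) :
    gramMat Ω w u (matAct A v) = gramMat Ω w u v * Aᴴ := by
  rw [← gramMat_conjTranspose, gramMat_matAct_left h, conjTranspose_mul, gramMat_conjTranspose]

lemma gramMat_mulVar_one_left (u : Fin a → MvPolynomial (Fin 2) ℂ)
    (v : Fin b → MvPolynomial (Fin 2) ℂ) :
    gramMat Ω w (mulVar 1 u) v = gramMat Ω w u (mulVar 0 v) := by
  ext k j
  exact cip_X_one_mul_left Ω w (u k) (v j)

lemma gramMat_mulVar_one_mulVar_one (u : Fin a → MvPolynomial (Fin 2) ℂ)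
    (v : Fin b → MvPolynomial (Fin 2) ℂ) :
    gramMat Ω w (mulVar 1 u) (mulVar 1 v) = gramMat Ω w (mulVar 0 u) (mulVar 0 v) := by
  ext k j
  exact cip_X_one_mul_X_one_mul Ω w (u k) (v j)

end gramMat

/-- Invariance of a vector of polynomials under conjugation combined with reversal of the
entries, `u = J conj(u)`. -/
def ConjSymm {a : ℕ} (u : Fin a → MvPolynomial (Fin 2) ℂ) : Prop :=
  ∀ k, u k = pconj (u k.rev)

lemma pconj_matAct_rev {a b : ℕ} (A : Matrix (Fin a) (Fin b) ℂ)
    {u : Fin b → MvPolynomial (Fin 2) ℂ} (hu : ConjSymm u) (k : Fin a) :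
    pconj (matAct A u k.rev) = matAct (vee A) u k := by
  rw [matAct, pconj_sum_smul, matAct, ← Equiv.sum_comp Fin.revPerm]
  refine Finset.sum_congr rfl fun j _ => ?_
  rw [vee_apply, hu j, Fin.revPerm_apply]

lemma mulVar_one_eq_of_mulVar_zero_eq {a b c : ℕ} {u : Fin a → MvPolynomial (Fin 2) ℂ}
    {v : Fin b → MvPolynomial (Fin 2) ℂ} {t : Fin c → MvPolynomial (Fin 2) ℂ}
    (hu : ConjSymm u) (hv : ConjSymm v) (ht : ConjSymm t)
    {A : Matrix (Fin a) (Fin b) ℂ} {B : Matrix (Fin a) (Fin a) ℂ} {C : Matrix (Fin a) (Fin c) ℂ}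
    (h : mulVar 0 u = matAct A v + matAct B u + matAct C t) :
    mulVar 1 u = matAct (vee A) v + matAct (vee B) u + matAct (vee C) t := by
  ext1 k
  have hk := congrArg pconj (congrFun h k.rev)
  simp only [Pi.add_apply, pconj_add, pconj_matAct_rev _ hu, pconj_matAct_rev _ hv,
    pconj_matAct_rev _ ht] at hk
  rw [mulVar, pconj_X_zero_mul, ← hu k] at hk
  exact hk

/-- The vector one level below the given one, empty at level `0`. -/
def prevVec (Q : (n : ℕ) → Fin (n+1) → MvPolynomial (Fin 2) ℂ) :
    (n : ℕ) → Fin n → MvPolynomial (Fin 2) ℂ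
  | 0 => Fin.elim0
  | n + 1 => Q n

/-- The coefficient `(α_{n-1}*)^∨` of `ℚ_{n-1}` in the three-term relation, empty at `n = 0`. -/
def lowerCoeff (α : (n : ℕ) → Matrix (Fin (n+1)) (Fin (n+2)) ℂ) :
    (n : ℕ) → Matrix (Fin (n+1)) (Fin n) ℂ
  | 0 => 0
  | n + 1 => vee ((α n)ᴴ)

lemma prevVec_succ (Q : (n : ℕ) → Fin (n+1) → MvPolynomial (Fin 2) ℂ) (n : ℕ) :
    prevVec Q (n + 1) = Q n := rfl

lemma lowerCoeff_succ (α : (n : ℕ) → Matrix (Fin (n+1)) (Fin (n+2)) ℂ) (n : ℕ) :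
    lowerCoeff α (n + 1) = vee ((α n)ᴴ) := rfl

/-- **commuting conditions.** For orthonormal bases `ℚ_n` of `𝒱_n²(w,ℂ)`
satisfying `ℚ_n = J_{n+1} conj(ℚ_n)` and the three-term relation
`z ℚ_n = α_n ℚ_{n+1} + β_n ℚ_n + (α_{n-1}*)^∨ ℚ_{n-1}`, the coefficient matrices satisfy
`α_n α_{n+1}^∨ = α_n^∨ α_{n+1}`,
`α_n β_{n+1}^∨ + β_n α_n^∨ = β_n^∨ α_n + α_n^∨ β_{n+1}`, and
`α_n α_n* + β_n β_n* + (α_{n-1}*)^∨ α_{n-1}^∨ = α_{n-1}^∨ (α_{n-1}^∨)* + β_n* β_n + α_n* α_n`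
(the last written here, in well-typed form, at level `n+1`). -/
theorem stmt_12 (Ω : Set ℂ) (w : ℂ → ℝ)
    (hw : ∀ z ∈ Ω, 0 ≤ w z)
    (hnorm : (∫ z in Ω, w z) = 1)
    (hInt : ∀ p q : MvPolynomial (Fin 2) ℂ,
      IntegrableOn (fun z => evalz p z * (starRingEnd ℂ) (evalz q z) * (w z : ℂ)) Ω)
    (hpos : ∀ p : MvPolynomial (Fin 2) ℂ, p ≠ 0 → 0 < cip Ω w p p)
    (Q : (n : ℕ) → Fin (n+1) → MvPolynomial (Fin 2) ℂ)
    (hmem : ∀ n k, memV Ω w n (Q n k))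
    (hon : ∀ n (k j : Fin (n+1)), cip Ω w (Q n k) (Q n j) = if k = j then 1 else 0)
    (hsymm : ∀ n (k : Fin (n+1)), Q n k = pconj (Q n k.rev))
    (α : (n : ℕ) → Matrix (Fin (n+1)) (Fin (n+2)) ℂ)
    (β : (n : ℕ) → Matrix (Fin (n+1)) (Fin (n+1)) ℂ)
    (hrel0 : ∀ k, X 0 * Q 0 k = ∑ j, α 0 k j • Q 1 j + ∑ j, β 0 k j • Q 0 j)
    (hrel : ∀ n (k : Fin (n+2)), X 0 * Q (n+1) k =
      ∑ j, α (n+1) k j • Q (n+2) j + ∑ j, β (n+1) k j • Q (n+1) j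
        + ∑ j, vee ((α n)ᴴ) k j • Q n j) :
    (∀ n, α n * vee (α (n+1)) = vee (α n) * α (n+1)) ∧
    (∀ n, α n * vee (β (n+1)) + β n * vee (α n) = vee (β n) * α n + vee (α n) * β (n+1)) ∧
    (∀ n, α (n+1) * (α (n+1))ᴴ + β (n+1) * (β (n+1))ᴴ + vee ((α n)ᴴ) * vee (α n)
      = vee (α (n+1)) * (vee (α (n+1)))ᴴ + (β (n+1))ᴴ * β (n+1) + (α n)ᴴ * α n) := by
  have hm : HasMoments Ω w := hInt
  have hone : ∀ n, gramMat Ω w (Q n) (Q n) = 1 := fun n => by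
    ext k j
    simp [gramMat, hon, Matrix.one_apply]
  have hgt : ∀ n m, m < n → gramMat Ω w (Q n) (Q m) = 0 := fun n m h => by
    ext k j
    exact (hmem n k).2 _ ((hmem m j).1.trans_lt h)
  have hlt : ∀ n m, n < m → gramMat Ω w (Q n) (Q m) = 0 := fun n m h => by
    rw [← gramMat_conjTranspose, hgt m n h, conjTranspose_zero]
  have hprev : ∀ n m, n ≤ m → gramMat Ω w (prevVec Q n) (Q m) = 0 := fun n m h => by
    cases n with
    | zero => ext k; exact k.elim0
    | succ n => exact hlt n m h
  have hprev' : ∀ n m, n ≤ m → gramMat Ω w (Q m) (prevVec Q n) = 0 := fun n m h => by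
    rw [← gramMat_conjTranspose, hprev n m h, conjTranspose_zero]
  have hz : ∀ n, mulVar 0 (Q n) = matAct (α n) (Q (n+1)) + matAct (β n) (Q n)
      + matAct (lowerCoeff α n) (prevVec Q n) := fun n => by
    ext1 k
    cases n with
    | zero => simpa [matAct, mulVar] using hrel0 k
    | succ n => exact hrel n k
  have hsymm_prev : ∀ n, ConjSymm (prevVec Q n) := fun n => by
    cases n with
    | zero => exact fun k => k.elim0
    | succ n => exact hsymm n
  have hzbar : ∀ n, mulVar 1 (Q n) = matAct (vee (α n)) (Q (n+1)) + matAct (vee (β n)) (Q n)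
      + matAct (vee (lowerCoeff α n)) (prevVec Q n) := fun n =>
    mulVar_one_eq_of_mulVar_zero_eq (hsymm n) (hsymm (n+1)) (hsymm_prev n) (hz n)
  have hβ : ∀ n, vee (β n) = (β n)ᴴ := fun n => by
    have h := gramMat_mulVar_one_left (Ω := Ω) (w := w) (Q n) (Q n)
    rw [hz, hzbar] at h
    simpa [gramMat_add_left hm, gramMat_add_right hm, gramMat_matAct_left hm,
      gramMat_matAct_right hm, hone, hgt, hlt, hprev, hprev'] using h
  refine ⟨fun n => ?_, fun n => ?_, fun n => ?_⟩
  · have h := gramMat_mulVar_one_mulVar_one (Ω := Ω) (w := w) (Q n) (Q (n+2))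
    rw [hz, hz, hzbar, hzbar] at h
    simp only [lowerCoeff_succ, prevVec_succ, vee_vee, vee_conjTranspose] at h
    simpa [gramMat_add_left hm, gramMat_add_right hm, gramMat_matAct_left hm,
      gramMat_matAct_right hm, hone, hgt, hlt, hprev, hprev', hprev n (n+2+1) (by omega)] using h.symm
  · have h := gramMat_mulVar_one_mulVar_one (Ω := Ω) (w := w) (Q n) (Q (n+1))
    rw [hz, hz, hzbar, hzbar] at h
    simp only [lowerCoeff_succ, prevVec_succ, vee_vee, vee_conjTranspose] at h
    simp [gramMat_add_left hm, gramMat_add_right hm, gramMat_matAct_left hm,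
      gramMat_matAct_right hm, hone, hgt, hlt, hprev, hprev n (n+1+1) (by omega), hβ] at h
    rw [hβ, hβ, add_comm ((β n)ᴴ * α n)]
    exact h.symm
  · have h := gramMat_mulVar_one_mulVar_one (Ω := Ω) (w := w) (Q (n+1)) (Q (n+1))
    rw [hz, hzbar] at h
    simp only [lowerCoeff_succ, prevVec_succ, vee_vee, vee_conjTranspose] at h
    simp [gramMat_add_left hm, gramMat_add_right hm, gramMat_matAct_left hm,
      gramMat_matAct_right hm, hone, hgt, hlt, hβ] at h
    rw [vee_conjTranspose]
    exact h.symm
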